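/- For every C₁ > 0 there exists δ₂ > 0 such that for all 0 < δ ≤ δ₂ and every W ∈ L²(0,1) with √(y(1-y)) ∂_y W ∈ L²(0,1) and ∫₀¹ W² dy ≤ C₁, the following nonlinear Poincaré-type inequality holds: -(1/δ)(∫₀¹ W² dy + 2∫₀¹ W dy)² + (1+δ)∫₀¹ W² dy + (2/3)∫₀¹ W³ dy + δ∫₀¹ |W|³ dy - (0.9 - δ)∫₀¹ y(1-y)|∂_y W|² dy ≤ 0. -/

import Mathlib

open MeasureTheory
open Set
open scoped ENNReal Interval

/-- Cauchy–Schwarz. -/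
lemma sq_lintegral_mul_le {α : Type*} [MeasurableSpace α] (μ : Measure α) {f g : α → ℝ≥0∞}
    (hf : AEMeasurable f μ) (hg : AEMeasurable g μ) :
    (∫⁻ x, f x * g x ∂μ) ^ 2 ≤ (∫⁻ x, f x ^ 2 ∂μ) * ∫⁻ x, g x ^ 2 ∂μ := by
  have h := ENNReal.lintegral_mul_le_Lp_mul_Lq μ Real.HolderConjugate.two_two hf hg
  have hs : ∀ a : ℝ≥0∞, (a ^ (1 / (2 : ℝ))) ^ 2 = a := fun a => by
    rw [← ENNReal.rpow_natCast, ← ENNReal.rpow_mul]; norm_num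
  simp only [ENNReal.rpow_two, Pi.mul_apply] at h
  calc _ ≤ _ := pow_le_pow_left₀ (by positivity) h 2
    _ = _ := by rw [mul_pow, hs, hs]

lemma enorm_sub_le_lintegral_uIoc {F F' : ℝ → ℝ} {x y : ℝ} (hF' : Measurable F')
    (hF : ∀ t ∈ uIcc x y, HasDerivAt F (F' t) t) :
    ‖F y - F x‖ₑ ≤ ∫⁻ t in Ι x y, ‖F' t‖ₑ := by
  by_cases h : ∫⁻ t in Ι x y, ‖F' t‖ₑ = ∞
  · simp [h]
  have hi : IntervalIntegrable F' volume x y :=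
    intervalIntegrable_iff.2 ⟨hF'.aestronglyMeasurable, lt_top_iff_ne_top.2 h⟩
  rw [← intervalIntegral.integral_eq_sub_of_hasDerivAt hF hi]
  rw [← ofReal_norm, intervalIntegral.norm_intervalIntegral_eq, ofReal_norm]
  exact enorm_integral_le_lintegral_enorm _

lemma measurableSet_mem_uIoc : MeasurableSet {q : (ℝ × ℝ) × ℝ | q.2 ∈ Ι q.1.1 q.1.2} := by
  have : {q : (ℝ × ℝ) × ℝ | q.2 ∈ Ι q.1.1 q.1.2} =
      {q | min q.1.1 q.1.2 < q.2} ∩ {q | q.2 ≤ max q.1.1 q.1.2} := rfl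
  rw [this]
  exact (measurableSet_lt (by fun_prop) (by fun_prop)).inter
    (measurableSet_le (by fun_prop) (by fun_prop))

lemma measurableSet_separated (t : ℝ) : MeasurableSet {p : ℝ × ℝ | t ∈ Ι p.1 p.2} :=
  measurableSet_mem_uIoc.preimage (f := fun p : ℝ × ℝ => (p, t)) (by fun_prop)

/-- Tonelli's theorem over triples `(x, y, t)` with `t` between `x` and `y`. -/
lemma lintegral_uIoc_mul_eq (ν : Measure (ℝ × ℝ)) [SFinite ν] (μ : Measure ℝ) [SFinite μ]
    {g : ℝ → ℝ≥0∞} {k : ℝ × ℝ → ℝ≥0∞} (hg : Measurable g) (hk : Measurable k) :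
    ∫⁻ p, (∫⁻ t in Ι p.1 p.2, g t ∂μ) * k p ∂ν =
      ∫⁻ t, g t * ∫⁻ p in {p | t ∈ Ι p.1 p.2}, k p ∂ν ∂μ := by
  have h1 : ∀ p : ℝ × ℝ, (∫⁻ t in Ι p.1 p.2, g t ∂μ) * k p =
      ∫⁻ t, {q : (ℝ × ℝ) × ℝ | q.2 ∈ Ι q.1.1 q.1.2}.indicator (fun q => g q.2 * k q.1) (p, t) ∂μ := by
    intro p
    rw [← lintegral_mul_const _ hg, ← lintegral_indicator measurableSet_uIoc]
    rfl
  have h2 : ∀ t : ℝ, g t * ∫⁻ p in {p | t ∈ Ι p.1 p.2}, k p ∂ν =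
      ∫⁻ p, {q : (ℝ × ℝ) × ℝ | q.2 ∈ Ι q.1.1 q.1.2}.indicator (fun q => g q.2 * k q.1) (p, t) ∂ν := by
    intro t
    rw [← lintegral_const_mul _ hk, ← lintegral_indicator (measurableSet_separated t)]
    rfl
  simp_rw [h1, h2]
  exact lintegral_lintegral_swap
    (Measurable.indicator (by fun_prop) measurableSet_mem_uIoc).aemeasurable

/-- Lebesgue measure on the open unit interval. -/
noncomputable abbrev unitMeasure : Measure ℝ := volume.restrict (Ioo 0 1)

instance : IsProbabilityMeasure unitMeasure := ⟨by simp⟩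

lemma ae_mem_unit_prod :
    ∀ᵐ p ∂(unitMeasure.prod unitMeasure), p.1 ∈ Ioo (0 : ℝ) 1 ∧ p.2 ∈ Ioo (0 : ℝ) 1 := by
  rw [Measure.prod_restrict]
  exact ae_restrict_mem (measurableSet_Ioo.prod measurableSet_Ioo)

lemma uIcc_subset_unit {x y : ℝ} (hx : x ∈ Ioo (0 : ℝ) 1) (hy : y ∈ Ioo (0 : ℝ) 1) :
    uIcc x y ⊆ Ioo 0 1 := ordConnected_Ioo.uIcc_subset hx hy

lemma lintegral_uIoc_unit {x y : ℝ} (hx : x ∈ Ioo (0 : ℝ) 1) (hy : y ∈ Ioo (0 : ℝ) 1)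
    (g : ℝ → ℝ≥0∞) : ∫⁻ t in Ι x y, g t ∂unitMeasure = ∫⁻ t in Ι x y, g t := by
  rw [Measure.restrict_restrict_of_subset
    (uIoc_subset_uIcc.trans (uIcc_subset_unit hx hy))]

lemma setLIntegral_separated {t : ℝ} (ht : t ∈ Ioo (0 : ℝ) 1) {k : ℝ × ℝ → ℝ≥0∞}
    (hk : Measurable k) :
    ∫⁻ p in {p | t ∈ Ι p.1 p.2}, k p ∂(unitMeasure.prod unitMeasure) =
      (∫⁻ x in Ioo 0 t, ∫⁻ y in Ico t 1, k (x, y)) + ∫⁻ x in Ico t 1, ∫⁻ y in Ioo 0 t, k (x, y) := by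
  have hset : {p : ℝ × ℝ | t ∈ Ι p.1 p.2} ∩ Ioo 0 1 ×ˢ Ioo 0 1 =
      Ioo 0 t ×ˢ Ico t 1 ∪ Ico t 1 ×ˢ Ioo 0 t := by
    obtain ⟨h0, h1⟩ := ht
    ext ⟨x, y⟩
    simp only [mem_inter_iff, mem_ofPred_eq, mem_uIoc, mem_prod, mem_Ioo, mem_union, mem_Ico]
    grind
  have hd : Disjoint (Ioo 0 t ×ˢ Ico t 1) (Ico t 1 ×ˢ Ioo (0 : ℝ) t) := by
    rw [Set.disjoint_left]
    rintro ⟨x, y⟩ h h'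
    simp only [mem_prod, mem_Ioo, mem_Ico] at h h'
    linarith [h.1.2, h'.1.1]
  rw [Measure.prod_restrict, Measure.restrict_restrict (measurableSet_separated t), hset,
    lintegral_union (measurableSet_Ico.prod measurableSet_Ioo) hd,
    ← Measure.prod_restrict, ← Measure.prod_restrict, lintegral_prod _ hk.aemeasurable,
    lintegral_prod _ hk.aemeasurable]

lemma measure_separated {t : ℝ} (ht : t ∈ Ioo (0 : ℝ) 1) :
    (unitMeasure.prod unitMeasure) {p | t ∈ Ι p.1 p.2} = ENNReal.ofReal (2 * (t * (1 - t))) := by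
  have h := setLIntegral_separated ht (k := fun _ => 1) measurable_const
  simp only [lintegral_const, one_mul, Measure.restrict_apply_univ, Real.volume_Ioo,
    Real.volume_Ico, sub_zero] at h
  obtain ⟨h0, h1⟩ := ht
  rw [h, ← ENNReal.ofReal_mul (by linarith), ← ENNReal.ofReal_mul (by linarith),
    ← ENNReal.ofReal_add (by nlinarith) (by nlinarith)]
  congr 1; ring

lemma lintegral_Ioo_Ico_sub {t : ℝ} (ht : t ∈ Ioo (0 : ℝ) 1) :
    ∫⁻ x in Ioo 0 t, ∫⁻ y in Ico t 1, ENNReal.ofReal |y - x| = ENNReal.ofReal (t * (1 - t) / 2) := by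
  obtain ⟨h0, h1⟩ := ht
  have hy : ∀ x ∈ Ioo 0 t, ∫⁻ y in Ico t 1, ENNReal.ofReal |y - x| =
      ENNReal.ofReal ((1 - x) ^ 2 / 2 - (t - x) ^ 2 / 2) := by
    intro x hx
    rw [← ofReal_integral_eq_lintegral_ofReal]
    · rw [setIntegral_congr_fun (g := fun y => y - x) measurableSet_Ico
        (fun y hy => abs_of_nonneg (by linarith [hx.2, hy.1])), integral_Ico_eq_integral_Ioc,
        ← intervalIntegral.integral_of_le h1.le]
      congr 1
      simp
      ring
    · exact (Continuous.integrableOn_Icc (by fun_prop)).mono_set Ico_subset_Icc_self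
    · exact .of_forall fun y => abs_nonneg _
  rw [setLIntegral_congr_fun measurableSet_Ioo hy, ← ofReal_integral_eq_lintegral_ofReal]
  · rw [← integral_Ioc_eq_integral_Ioo, ← intervalIntegral.integral_of_le h0.le]
    congr 1
    have : ∀ x : ℝ, (1 - x) ^ 2 / 2 - (t - x) ^ 2 / 2 = (1 - t ^ 2) / 2 - (1 - t) * x :=
      fun x => by ring
    simp_rw [this]
    rw [intervalIntegral.integral_sub (by simp) (by apply Continuous.intervalIntegrable; fun_prop),
      intervalIntegral.integral_const_mul]
    simp
    ring
  · exact (Continuous.integrableOn_Icc (by fun_prop)).mono_set Ioo_subset_Icc_self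
  · filter_upwards [ae_restrict_mem measurableSet_Ioo] with x hx
    simp only [Pi.zero_apply]
    nlinarith [hx.2]

lemma setLIntegral_separated_sub {t : ℝ} (ht : t ∈ Ioo (0 : ℝ) 1) :
    ∫⁻ p in {p | t ∈ Ι p.1 p.2}, ENNReal.ofReal |p.2 - p.1| ∂(unitMeasure.prod unitMeasure) =
      ENNReal.ofReal (t * (1 - t)) := by
  have hm : Measurable fun p : ℝ × ℝ => ENNReal.ofReal |p.2 - p.1| := by fun_prop
  rw [setLIntegral_separated ht hm,
    lintegral_lintegral_swap (μ := volume.restrict (Ico t 1)) (ν := volume.restrict (Ioo 0 t))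
      (f := fun x y => ENNReal.ofReal |y - x|) (by fun_prop)]
  have h : ∫⁻ y in Ioo 0 t, ∫⁻ x in Ico t 1, ENNReal.ofReal |y - x| =
      ENNReal.ofReal (t * (1 - t) / 2) := by
    rw [← lintegral_Ioo_Ico_sub ht]
    exact lintegral_congr fun y => lintegral_congr fun x => by rw [abs_sub_comm]
  have hp : 0 ≤ t * (1 - t) / 2 := by nlinarith [ht.1, ht.2]
  rw [h, lintegral_Ioo_Ico_sub ht, ← ENNReal.ofReal_add hp hp, add_halves]

/-- Sharp Poincaré inequality for the weight `t (1 - t)`, as a double integral. -/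
lemma lintegral_enorm_sub_sq_le {f f' : ℝ → ℝ} (hf' : Measurable f')
    (hd : ∀ t ∈ Ioo (0 : ℝ) 1, HasDerivAt f (f' t) t) :
    ∫⁻ p, ‖f p.2 - f p.1‖ₑ ^ 2 ∂(unitMeasure.prod unitMeasure) ≤
      ∫⁻ t, ENNReal.ofReal (t * (1 - t)) * ‖f' t‖ₑ ^ 2 ∂unitMeasure := by
  calc ∫⁻ p, ‖f p.2 - f p.1‖ₑ ^ 2 ∂(unitMeasure.prod unitMeasure)
      ≤ ∫⁻ p, (∫⁻ t in Ι p.1 p.2, ‖f' t‖ₑ ^ 2 ∂unitMeasure) * ENNReal.ofReal |p.2 - p.1|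
          ∂(unitMeasure.prod unitMeasure) := by
        refine lintegral_mono_ae ?_
        filter_upwards [ae_mem_unit_prod] with p hp
        rw [lintegral_uIoc_unit hp.1 hp.2]
        have h := sq_lintegral_mul_le (volume.restrict (Ι p.1 p.2))
          (f := fun t => ‖f' t‖ₑ) (g := fun _ => 1) (by fun_prop) (by fun_prop)
        simp only [mul_one, one_pow, lintegral_const, Measure.restrict_apply_univ, one_mul,
          Real.volume_uIoc] at h
        exact (pow_le_pow_left₀ (by positivity) (enorm_sub_le_lintegral_uIoc hf'
          fun t ht => hd t (uIcc_subset_unit hp.1 hp.2 ht)) 2).trans h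
    _ = _ := by
        rw [lintegral_uIoc_mul_eq _ _ (by fun_prop) (by fun_prop)]
        refine setLIntegral_congr_fun measurableSet_Ioo fun t ht => ?_
        simp only [setLIntegral_separated_sub ht, mul_comm]

/-- The covariance of `f ^ 2` and `f` is controlled by the weighted Dirichlet energy. -/
lemma sq_lintegral_enorm_sub_mul_le {f f' : ℝ → ℝ} (hf : Measurable f) (hf' : Measurable f')
    (hd : ∀ t ∈ Ioo (0 : ℝ) 1, HasDerivAt f (f' t) t) :
    (∫⁻ p, ‖f p.2 ^ 2 - f p.1 ^ 2‖ₑ * ‖f p.2 - f p.1‖ₑ ∂(unitMeasure.prod unitMeasure)) ^ 2 ≤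
      8 * (∫⁻ t, ‖f t‖ₑ ^ 2 ∂unitMeasure) *
        (∫⁻ p, ‖f p.2 - f p.1‖ₑ ^ 2 ∂(unitMeasure.prod unitMeasure)) *
        ∫⁻ t, ENNReal.ofReal (t * (1 - t)) * ‖f' t‖ₑ ^ 2 ∂unitMeasure := by
  set V := ∫⁻ p, ‖f p.2 - f p.1‖ₑ ^ 2 ∂(unitMeasure.prod unitMeasure)
  set J : ℝ → ℝ≥0∞ := fun t => ∫⁻ p in {p | t ∈ Ι p.1 p.2}, ‖f p.2 - f p.1‖ₑ
    ∂(unitMeasure.prod unitMeasure) with hJ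
  have hk : Measurable fun p : ℝ × ℝ => ‖f p.2 - f p.1‖ₑ := by fun_prop
  have hJm : Measurable J := by
    have : J = fun t => ∫⁻ p, {q : (ℝ × ℝ) × ℝ | q.2 ∈ Ι q.1.1 q.1.2}.indicator
        (fun q => ‖f q.1.2 - f q.1.1‖ₑ) (p, t) ∂(unitMeasure.prod unitMeasure) := by
      funext t
      simp only [hJ, ← lintegral_indicator (measurableSet_separated t)]
      rfl
    rw [this]
    exact Measurable.lintegral_prod_left'
      (Measurable.indicator (by fun_prop) measurableSet_mem_uIoc)
  have hJle : ∀ t ∈ Ioo (0 : ℝ) 1, J t ^ 2 ≤ ENNReal.ofReal (t * (1 - t)) * (2 * V) := by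
    intro t ht
    have h := sq_lintegral_mul_le ((unitMeasure.prod unitMeasure).restrict {p | t ∈ Ι p.1 p.2})
      (f := fun _ => 1) aemeasurable_const hk.aemeasurable
    simp only [one_mul, one_pow, lintegral_const, Measure.restrict_apply_univ,
      measure_separated ht] at h
    refine h.trans ?_
    rw [ENNReal.ofReal_mul zero_le_two, mul_comm (ENNReal.ofReal 2), mul_assoc,
      ENNReal.ofReal_ofNat]
    gcongr
    exact setLIntegral_le_lintegral _ _
  have hle : ∫⁻ p, ‖f p.2 ^ 2 - f p.1 ^ 2‖ₑ * ‖f p.2 - f p.1‖ₑ ∂(unitMeasure.prod unitMeasure) ≤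
      ∫⁻ t, ‖2 * f t‖ₑ * (‖f' t‖ₑ * J t) ∂unitMeasure := by
    calc _ ≤ ∫⁻ p, (∫⁻ t in Ι p.1 p.2, ‖2 * f t * f' t‖ₑ ∂unitMeasure) * ‖f p.2 - f p.1‖ₑ
          ∂(unitMeasure.prod unitMeasure) := by
          refine lintegral_mono_ae ?_
          filter_upwards [ae_mem_unit_prod] with p hp
          rw [lintegral_uIoc_unit hp.1 hp.2]
          gcongr
          refine enorm_sub_le_lintegral_uIoc (F := fun t => f t ^ 2) (by fun_prop) fun t ht => ?_
          simpa using (hd t (uIcc_subset_unit hp.1 hp.2 ht)).fun_pow 2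
      _ = _ := by
          rw [lintegral_uIoc_mul_eq _ _ (by fun_prop) hk]
          simp only [enorm_mul, hJ, mul_assoc]
  calc _ ≤ (∫⁻ t, ‖2 * f t‖ₑ * (‖f' t‖ₑ * J t) ∂unitMeasure) ^ 2 :=
        pow_le_pow_left₀ (by positivity) hle 2
    _ ≤ (∫⁻ t, ‖2 * f t‖ₑ ^ 2 ∂unitMeasure) * ∫⁻ t, (‖f' t‖ₑ * J t) ^ 2 ∂unitMeasure :=
        sq_lintegral_mul_le _ (by fun_prop) (by fun_prop)
    _ ≤ (4 * ∫⁻ t, ‖f t‖ₑ ^ 2 ∂unitMeasure) *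
          ((∫⁻ t, ENNReal.ofReal (t * (1 - t)) * ‖f' t‖ₑ ^ 2 ∂unitMeasure) * (2 * V)) := by
        gcongr
        · rw [← lintegral_const_mul _ (by fun_prop)]
          refine lintegral_mono fun t => le_of_eq ?_
          rw [enorm_mul, mul_pow]
          congr 1
          rw [Real.enorm_eq_ofReal (by norm_num)]
          norm_num
        · rw [← lintegral_mul_const _ (by fun_prop)]
          refine lintegral_mono_ae ?_
          filter_upwards [ae_restrict_mem measurableSet_Ioo] with t ht
          rw [mul_pow, mul_right_comm, mul_comm]
          gcongr
          exact hJle t ht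
    _ = _ := by ring

lemma integral_sub_mul_sub {α : Type*} [MeasurableSpace α] (μ : Measure α) [IsProbabilityMeasure μ]
    {F G : α → ℝ} (hF : Integrable F μ) (hG : Integrable G μ)
    (hFG : Integrable (fun x => F x * G x) μ) :
    Integrable (fun p : α × α => (F p.2 - F p.1) * (G p.2 - G p.1)) (μ.prod μ) ∧
      ∫ p, (F p.2 - F p.1) * (G p.2 - G p.1) ∂(μ.prod μ) =
        2 * (∫ x, F x * G x ∂μ - (∫ x, F x ∂μ) * ∫ x, G x ∂μ) := by
  have e : (fun p : α × α => (F p.2 - F p.1) * (G p.2 - G p.1)) =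
      fun p => (F p.2 * G p.2 + F p.1 * G p.1) - (F p.1 * G p.2 + G p.1 * F p.2) := by
    funext p; ring
  have h1 : Integrable (fun p : α × α => F p.2 * G p.2) (μ.prod μ) := hFG.comp_snd μ
  have h2 : Integrable (fun p : α × α => F p.1 * G p.1) (μ.prod μ) := hFG.comp_fst μ
  have h3 : Integrable (fun p : α × α => F p.1 * G p.2) (μ.prod μ) := hF.mul_prod hG
  have h4 : Integrable (fun p : α × α => G p.1 * F p.2) (μ.prod μ) := hG.mul_prod hF
  have h12 : Integrable (fun p : α × α => F p.2 * G p.2 + F p.1 * G p.1) (μ.prod μ) := h1.add h2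
  have h34 : Integrable (fun p : α × α => F p.1 * G p.2 + G p.1 * F p.2) (μ.prod μ) := h3.add h4
  rw [e]
  refine ⟨h12.sub h34, ?_⟩
  rw [integral_sub h12 h34, integral_add h1 h2, integral_add h3 h4,
    integral_prod_mul, integral_prod_mul, integral_fun_snd (fun x => F x * G x),
    integral_fun_fst (fun x => F x * G x)]
  simp
  ring

lemma lintegral_enorm_sq {α : Type*} [MeasurableSpace α] {μ : Measure α} {g : α → ℝ}
    (hg : Integrable (fun x => g x ^ 2) μ) :
    ∫⁻ x, ‖g x‖ₑ ^ 2 ∂μ = ENNReal.ofReal (∫ x, g x ^ 2 ∂μ) := by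
  rw [ofReal_integral_eq_lintegral_ofReal hg (.of_forall fun x => sq_nonneg _)]
  refine lintegral_congr fun x => ?_
  rw [← enorm_pow, Real.enorm_eq_ofReal (sq_nonneg _)]

lemma lintegral_weight_enorm_sq {g : ℝ → ℝ}
    (hg : Integrable (fun t => t * (1 - t) * g t ^ 2) unitMeasure) :
    ∫⁻ t, ENNReal.ofReal (t * (1 - t)) * ‖g t‖ₑ ^ 2 ∂unitMeasure =
      ENNReal.ofReal (∫ t, t * (1 - t) * g t ^ 2 ∂unitMeasure) := by
  rw [ofReal_integral_eq_lintegral_ofReal hg]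
  · refine setLIntegral_congr_fun measurableSet_Ioo fun t ht => ?_
    rw [ENNReal.ofReal_mul (mul_nonneg ht.1.le (by linarith [ht.2])), ← enorm_pow,
      Real.enorm_eq_ofReal (sq_nonneg _)]
  · filter_upwards [ae_restrict_mem measurableSet_Ioo] with t ht
    exact mul_nonneg (mul_nonneg ht.1.le (by linarith [ht.2])) (sq_nonneg _)

lemma integral_weight_nonneg (g : ℝ → ℝ) :
    0 ≤ ∫ t, t * (1 - t) * g t ^ 2 ∂unitMeasure :=
  setIntegral_nonneg measurableSet_Ioo fun t ht =>
    mul_nonneg (mul_nonneg ht.1.le (by linarith [ht.2])) (sq_nonneg _)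

lemma lintegral_enorm_sub_sq_eq {f : ℝ → ℝ} (h1 : Integrable f unitMeasure)
    (h2 : Integrable (fun t => f t ^ 2) unitMeasure) :
    ∫⁻ p, ‖f p.2 - f p.1‖ₑ ^ 2 ∂(unitMeasure.prod unitMeasure) =
      ENNReal.ofReal (2 * (∫ t, f t ^ 2 ∂unitMeasure - (∫ t, f t ∂unitMeasure) ^ 2)) := by
  obtain ⟨hi, he⟩ := integral_sub_mul_sub unitMeasure h1 h1 (by simpa only [← sq] using h2)
  simp only [← sq] at hi he
  rw [lintegral_enorm_sq hi, he]

lemma sq_integral_le_integral_sq {f : ℝ → ℝ} (h1 : Integrable f unitMeasure)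
    (h2 : Integrable (fun t => f t ^ 2) unitMeasure) :
    (∫ t, f t ∂unitMeasure) ^ 2 ≤ ∫ t, f t ^ 2 ∂unitMeasure := by
  obtain ⟨-, he⟩ := integral_sub_mul_sub unitMeasure h1 h1 (by simpa only [← sq] using h2)
  simp only [← sq] at he
  have : 0 ≤ ∫ p, (f p.2 - f p.1) ^ 2 ∂(unitMeasure.prod unitMeasure) :=
    integral_nonneg fun p => sq_nonneg _
  linarith

/-- Sharp Poincaré inequality for the weight `t (1 - t)`. -/
lemma two_mul_variance_le {f f' : ℝ → ℝ} (hf' : Measurable f')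
    (hd : ∀ t ∈ Ioo (0 : ℝ) 1, HasDerivAt f (f' t) t) (h1 : Integrable f unitMeasure)
    (h2 : Integrable (fun t => f t ^ 2) unitMeasure)
    (hD : Integrable (fun t => t * (1 - t) * f' t ^ 2) unitMeasure) :
    2 * (∫ t, f t ^ 2 ∂unitMeasure - (∫ t, f t ∂unitMeasure) ^ 2) ≤
      ∫ t, t * (1 - t) * f' t ^ 2 ∂unitMeasure := by
  have h := lintegral_enorm_sub_sq_le hf' hd
  rwa [lintegral_enorm_sub_sq_eq h1 h2, lintegral_weight_enorm_sq hD,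
    ENNReal.ofReal_le_ofReal_iff (integral_weight_nonneg _)] at h

/-- Bound on the covariance of `f ^ 2` with a contraction of `f`. -/
lemma sq_covariance_le {f f' g : ℝ → ℝ} (hf : Measurable f) (hf' : Measurable f')
    (hd : ∀ t ∈ Ioo (0 : ℝ) 1, HasDerivAt f (f' t) t) (h1 : Integrable f unitMeasure)
    (h2 : Integrable (fun t => f t ^ 2) unitMeasure)
    (hD : Integrable (fun t => t * (1 - t) * f' t ^ 2) unitMeasure)
    (hg : Integrable g unitMeasure) (h3 : Integrable (fun t => f t ^ 2 * g t) unitMeasure)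
    (hgf : ∀ x y, |g y - g x| ≤ |f y - f x|) :
    (∫ t, f t ^ 2 * g t ∂unitMeasure - (∫ t, f t ^ 2 ∂unitMeasure) * ∫ t, g t ∂unitMeasure) ^ 2 ≤
      4 * (∫ t, f t ^ 2 ∂unitMeasure) *
        (∫ t, f t ^ 2 ∂unitMeasure - (∫ t, f t ∂unitMeasure) ^ 2) *
        ∫ t, t * (1 - t) * f' t ^ 2 ∂unitMeasure := by
  have hA : 0 ≤ ∫ t, f t ^ 2 ∂unitMeasure := integral_nonneg fun t => sq_nonneg _
  have hS := sq_integral_le_integral_sq h1 h2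
  have hDn := integral_weight_nonneg f'
  obtain ⟨-, he⟩ := integral_sub_mul_sub unitMeasure h2 hg h3
  have h := sq_lintegral_enorm_sub_mul_le hf hf' hd
  rw [lintegral_enorm_sub_sq_eq h1 h2, lintegral_weight_enorm_sq hD, lintegral_enorm_sq h2] at h
  have hle : ‖∫ p, (f p.2 ^ 2 - f p.1 ^ 2) * (g p.2 - g p.1) ∂(unitMeasure.prod unitMeasure)‖ₑ ≤
      ∫⁻ p, ‖f p.2 ^ 2 - f p.1 ^ 2‖ₑ * ‖f p.2 - f p.1‖ₑ ∂(unitMeasure.prod unitMeasure) := by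
    refine (enorm_integral_le_lintegral_enorm _).trans (lintegral_mono fun p => ?_)
    rw [enorm_mul]
    gcongr
    exact enorm_le_iff_norm_le.2 (hgf _ _)
  have h' := (pow_le_pow_left₀ (by positivity) hle 2).trans h
  rw [he, ← enorm_pow, Real.enorm_eq_ofReal (sq_nonneg _),
    show (8 : ℝ≥0∞) = ENNReal.ofReal 8 by simp,
    ← ENNReal.ofReal_mul (by norm_num), ← ENNReal.ofReal_mul (by positivity),
    ← ENNReal.ofReal_mul (by nlinarith), ENNReal.ofReal_le_ofReal_iff
      (mul_nonneg (mul_nonneg (by positivity) (by linarith)) hDn)] at h'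
  linarith

lemma cubic_moment_le_of_small {S D X Q u : ℝ} (hS : 0 ≤ S) (hP : 2 * S ≤ D)
    (hN : 1 + Q = u ^ 2 + S) (hX : X ^ 2 ≤ 4 * (1 + Q) * S * D) (hQ : Q ≤ 1 / 20) :
    (2 / 3) * ((1 + Q) * u + X - 1) - Q ≤ 1.1 * Q ^ 2 + 0.8 * D := by
  have hD : 0 ≤ D := by linarith
  have hN0 : 0 ≤ 1 + Q := by rw [hN]; positivity
  obtain ⟨N, hN1, hNN⟩ : ∃ N : ℝ, 0 ≤ N ∧ N ^ 2 = 1 + Q :=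
    ⟨√(1 + Q), Real.sqrt_nonneg _, Real.sq_sqrt hN0⟩
  have hNle : N ≤ 1.025 := le_of_sq_le_sq (by norm_num; linarith) (by norm_num)
  have hXle : X ≤ N * (1.4 * S + D / 1.4) := by
    refine le_of_sq_le_sq ?_ (by positivity)
    have h := mul_nonneg (sq_nonneg N) (sq_nonneg (1.4 * S - D / 1.4))
    rw [← hNN] at hX
    refine hX.trans (le_of_sub_nonneg (h.trans_eq ?_))
    ring
  have hu : (1 + Q) * u ≤ N ^ 3 - N * S / 2 := by
    have h : N * u ≤ N ^ 2 - S / 2 := by nlinarith only [sq_nonneg (N - u), hNN, hN]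
    rw [← hNN]
    calc N ^ 2 * u = N * (N * u) := by ring
      _ ≤ N * (N ^ 2 - S / 2) := by gcongr
      _ = _ := by ring
  have hcube : (2 / 3) * (N ^ 3 - 1) - Q ≤ 1.1 * Q ^ 2 := by
    have hq : Q = (N - 1) * (N + 1) := by linear_combination -hNN
    have e : (2 / 3) * (N ^ 3 - 1) - Q = (N - 1) ^ 2 * ((2 * N + 1) / 3) := by
      rw [hq]; ring
    rw [e, hq, mul_pow]
    have : (2 * N + 1) / 3 ≤ 1.1 * (N + 1) ^ 2 := by nlinarith only [hN1]
    linarith only [mul_le_mul_of_nonneg_left this (sq_nonneg (N - 1))]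
  have hlin : N * (0.9 * S + D / 1.4) ≤ 1.025 * (1.165 * D) := by
    gcongr
    norm_num
    linarith
  linarith

lemma cubic_moment_le_of_mean_neg {S D X Q u : ℝ} (hS : 0 ≤ S) (hD : 0 ≤ D)
    (hN : 1 + Q = u ^ 2 + S) (hX : X ^ 2 ≤ 4 * (1 + Q) * S * D) (hQ : |Q| ≤ 1 / 20)
    (hu : u ≤ 0) :
    (2 / 3) * ((1 + Q) * u + X - 1) - Q ≤ 0.8 * D - 0.003 := by
  obtain ⟨hQ1, hQ2⟩ := abs_le.1 hQ
  have hXle : X ≤ 1.2 * D + 0.92 := by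
    refine le_of_sq_le_sq ?_ (by positivity)
    have h1 : (1 + Q) * (S * D) ≤ 1.05 * (1.05 * D) := by
      have : S ≤ 1.05 := by norm_num; linarith [sq_nonneg u]
      gcongr
      norm_num; linarith
    nlinarith only [sq_nonneg (1.2 * D - 0.92), h1, hX, hD]
  have h1 : (1 + Q) * u ≤ 0 := mul_nonpos_of_nonneg_of_nonpos (by linarith) hu
  linarith

lemma cubic_moment_le_of_bounded {c S D X Q M : ℝ} (hc : 1 ≤ c) (hS : 0 ≤ S) (hSc : S ≤ c)
    (hD : 0 ≤ D) (hQ0 : 0 ≤ 1 + Q) (hQc : |Q| ≤ 3 * c) (hMc : M ≤ c)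
    (hX : X ^ 2 ≤ 4 * (1 + Q) * S * D) :
    (2 / 3) * ((1 + Q) * (1 + M) + X - 1) - Q ≤ 15 * c ^ 2 + 0.5 * D := by
  obtain ⟨hQ1, hQ2⟩ := abs_le.1 hQc
  have h1 : (1 + Q) * (1 + M) ≤ 4 * c * (2 * c) := by
    calc (1 + Q) * (1 + M) ≤ (1 + Q) * (2 * c) := by gcongr; linarith
      _ ≤ _ := by gcongr; linarith
  have hXle : X ≤ D / 2 + 8 * c ^ 2 := by
    refine le_of_sq_le_sq ?_ (by positivity)
    have h1 : (1 + Q) * (S * D) ≤ 4 * c * (c * D) := by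
      gcongr; linarith
    nlinarith only [sq_nonneg (D / 2 - 8 * c ^ 2), h1, hX]
  have hcc : c ≤ c ^ 2 := by nlinarith only [hc]
  nlinarith only [h1, hXle, hcc, hQ1, hD]

/-- With `A`, `M`, `T`, `E`, `D` the integrals of `W ^ 2`, `W`, `W ^ 3`, `|W| ^ 3` and the weighted
energy, the inequality follows from the Poincaré and covariance estimates. -/
lemma moment_inequality {c δ A M D X T E B : ℝ} (hc : 1 ≤ c) (hδ : 0 < δ)
    (hδc : δ * (10000 * c ^ 2) ≤ 1) (hMA : M ^ 2 ≤ A) (hAc : A ≤ c)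
    (hP : 2 * (A - M ^ 2) ≤ D)
    (hX : X ^ 2 ≤ 4 * (1 + (A + 2 * M)) * (A - M ^ 2) * D)
    (hT : T = (1 + (A + 2 * M)) * (1 + M) + X - 1 - 3 * M - 3 * A)
    (hBA : B ^ 2 ≤ A) (hE : (E - A * B) ^ 2 ≤ 4 * A * (A - M ^ 2) * D) :
    -(1 / δ) * (A + 2 * M) ^ 2 + (1 + δ) * A + (2 / 3) * T + δ * E - (0.9 - δ) * D ≤ 0 := by
  obtain ⟨S, hS⟩ : ∃ S, S = A - M ^ 2 := ⟨_, rfl⟩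
  obtain ⟨Q, hQ⟩ : ∃ Q, Q = A + 2 * M := ⟨_, rfl⟩
  rw [← hS] at hP hX hE
  rw [← hQ] at hX hT ⊢
  have hS0 : 0 ≤ S := by linarith
  have hD0 : 0 ≤ D := by linarith
  have hA0 : 0 ≤ A := (sq_nonneg M).trans hMA
  have hSA : S ≤ A := by linarith [sq_nonneg M]
  have hcc : c ≤ c ^ 2 := by nlinarith only [hc]
  have hδc1 : δ * c * 10000 ≤ 1 := by nlinarith only [hδc, hcc, hδ]
  have hδc2 : 0 ≤ δ * c := by positivity
  have hsmall : δ * A + δ * E + δ * D ≤ 3 * (δ * c) * (A + D) := by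
    have hB : B ≤ c := le_of_sq_le_sq (by linarith) (by linarith)
    have h1 : E - A * B ≤ 1.5 * c * D := by
      refine le_of_sq_le_sq ?_ (by positivity)
      have h2 : A * (S * D) ≤ c ^ 2 * (D / 2 * D) := by gcongr <;> linarith
      nlinarith only [h2, hE, mul_nonneg (sq_nonneg c) (sq_nonneg D)]
    have h2 : A * B ≤ A * c := by gcongr
    have h3 : 1 * (A + D) ≤ c * (A + D) := by gcongr
    have h4 : A + E + D ≤ 3 * c * (A + D) := by
      nlinarith only [h1, h2, h3, mul_nonneg (zero_le_one.trans hc) hD0,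
        mul_nonneg (zero_le_one.trans hc) hA0]
    linarith only [mul_le_mul_of_nonneg_left h4 hδ.le]
  have hmain : A + (2 / 3) * T = (2 / 3) * ((1 + Q) * (1 + M) + X - 1) - Q := by
    rw [hT, hQ]; ring
  have hN : 1 + Q = (1 + M) ^ 2 + S := by rw [hQ, hS]; ring
  have hinv : 10000 * c ^ 2 ≤ 1 / δ := by
    rw [le_div_iff₀ hδ]; linarith
  suffices h : (2 / 3) * ((1 + Q) * (1 + M) + X - 1) - Q + 3 * (δ * c) * (A + D) ≤
      10000 * c ^ 2 * Q ^ 2 + 0.9 * D by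
    have := mul_le_mul_of_nonneg_right hinv (sq_nonneg Q)
    linarith
  have h7 := mul_le_mul_of_nonneg_right hδc1 (sq_nonneg Q)
  have h8 := mul_le_mul_of_nonneg_right hδc hD0
  have h9 := mul_le_mul_of_nonneg_right hδc1 hD0
  have h10 : δ * c * A ≤ δ * c * c := by gcongr
  by_cases hQs : |Q| ≤ 1 / 20
  · rcases le_or_gt 0 (1 + M) with hu | hu
    · have hQ2 := cubic_moment_le_of_small hS0 hP hN hX (abs_le.1 hQs).2
      have hM2 : M ^ 2 ≤ 2 * Q ^ 2 + 2 * S ^ 2 := by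
        have h1 : M * (M + 2) = Q - S := by rw [hQ, hS]; ring
        have h2 : M ^ 2 ≤ (Q - S) ^ 2 := by
          rw [← h1, mul_pow]
          exact le_mul_of_one_le_right (sq_nonneg M) (by nlinarith only [hu])
        linarith only [h2, sq_nonneg (Q + S)]
      have hSc : S * S ≤ c * (D / 2) := by gcongr <;> linarith
      have hDc : 1 * D ≤ c * D := by gcongr
      have hAle : A + D ≤ 2 * Q ^ 2 + 2.5 * c * D := by linarith only [hM2, hSc, hDc, hS, hP]
      have h6 := mul_le_mul_of_nonneg_left hAle hδc2
      have h11 : 1 * Q ^ 2 ≤ c ^ 2 * Q ^ 2 := by gcongr; linarith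
      linarith only [h6, h7, h8, h11, hQ2, sq_nonneg Q, hD0]
    · have h := cubic_moment_le_of_mean_neg hS0 hD0 hN hX hQs hu.le
      linarith only [h, h9, h10, hδc, mul_nonneg (sq_nonneg c) (sq_nonneg Q), hD0]
  · have hQ2 : 1 / 400 ≤ Q ^ 2 := by
      rw [← sq_abs]; nlinarith only [hQs]
    obtain ⟨hM1, hM2⟩ : -c ≤ M ∧ M ≤ c := abs_le_of_sq_le_sq' (by linarith) (by linarith)
    have h := cubic_moment_le_of_bounded hc hS0 (hSA.trans hAc) hD0 (by rw [hN]; positivity)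
      (abs_le.2 ⟨by linarith, by linarith⟩) hM2 hX
    have h3 : 10000 * c ^ 2 * (1 / 400) ≤ 10000 * c ^ 2 * Q ^ 2 := by gcongr
    linarith only [h, h3, h9, h10, hδc, hc, hcc, hD0]

/-- The inequality for measurable data, with integrals against `unitMeasure`. -/
lemma nonlinear_poincare_of_measurable {c δ : ℝ} (hc : 1 ≤ c) (hδ : 0 < δ)
    (hδc : δ * (10000 * c ^ 2) ≤ 1) {f f' : ℝ → ℝ} (hf : Measurable f) (hf' : Measurable f')
    (hd : ∀ t ∈ Ioo (0 : ℝ) 1, HasDerivAt f (f' t) t) (h1 : Integrable f unitMeasure)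
    (h2 : Integrable (fun t => f t ^ 2) unitMeasure)
    (h3 : Integrable (fun t => |f t| ^ 3) unitMeasure)
    (hD : Integrable (fun t => t * (1 - t) * f' t ^ 2) unitMeasure)
    (hfc : ∫ t, f t ^ 2 ∂unitMeasure ≤ c) :
    -(1 / δ) * ((∫ t, f t ^ 2 ∂unitMeasure) + 2 * ∫ t, f t ∂unitMeasure) ^ 2 +
        (1 + δ) * (∫ t, f t ^ 2 ∂unitMeasure) + (2 / 3) * (∫ t, f t ^ 3 ∂unitMeasure) +
        δ * (∫ t, |f t| ^ 3 ∂unitMeasure) -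
        (0.9 - δ) * (∫ t, t * (1 - t) * f' t ^ 2 ∂unitMeasure) ≤ 0 := by
  have h3' : Integrable (fun t => f t ^ 3) unitMeasure :=
    h3.mono (by fun_prop) (.of_forall fun t => by simp)
  have habs : ∀ t, f t ^ 2 * |f t| = |f t| ^ 3 := fun t => by rw [← sq_abs]; ring
  have g1 : Integrable (fun t => f t + 1) unitMeasure := h1.add (integrable_const 1)
  have e2 : ∀ t, (f t + 1) ^ 2 = f t ^ 2 + (2 * f t + 1) := fun t => by ring
  have e3 : ∀ t, (f t + 1) ^ 2 * (f t + 1) = f t ^ 3 + (3 * f t ^ 2 + (3 * f t + 1)) :=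
    fun t => by ring
  have i1 : Integrable (fun t => 2 * f t + 1) unitMeasure :=
    (h1.const_mul 2).add (integrable_const 1)
  have i2 : Integrable (fun t => 3 * f t + 1) unitMeasure :=
    (h1.const_mul 3).add (integrable_const 1)
  have i3 : Integrable (fun t => 3 * f t ^ 2 + (3 * f t + 1)) unitMeasure :=
    (h2.const_mul 3).add i2
  have g2 : Integrable (fun t => (f t + 1) ^ 2) unitMeasure := by
    simp_rw [e2]; exact h2.add i1
  have g3 : Integrable (fun t => (f t + 1) ^ 2 * (f t + 1)) unitMeasure := by
    simp_rw [e3]; exact h3'.add i3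
  have I1 : ∫ t, (f t + 1) ∂unitMeasure = 1 + ∫ t, f t ∂unitMeasure := by
    rw [integral_add h1 (integrable_const 1)]; simp [add_comm]
  have I2 : ∫ t, (f t + 1) ^ 2 ∂unitMeasure =
      1 + (∫ t, f t ^ 2 ∂unitMeasure + 2 * ∫ t, f t ∂unitMeasure) := by
    simp_rw [e2]
    rw [integral_add h2 i1, integral_add (h1.const_mul 2) (integrable_const 1),
      integral_const_mul]
    simp only [integral_const, probReal_univ, smul_eq_mul]
    ring
  have I3 : ∫ t, (f t + 1) ^ 2 * (f t + 1) ∂unitMeasure = ∫ t, f t ^ 3 ∂unitMeasure +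
      3 * ∫ t, f t ^ 2 ∂unitMeasure + 3 * ∫ t, f t ∂unitMeasure + 1 := by
    simp_rw [e3]
    rw [integral_add h3' i3, integral_add (h2.const_mul 3) i2,
      integral_add (h1.const_mul 3) (integrable_const 1), integral_const_mul, integral_const_mul]
    simp only [integral_const, probReal_univ, smul_eq_mul]
    ring
  have hX := sq_covariance_le (hf.add_const 1) hf' (fun t ht => (hd t ht).add_const 1) g1 g2 hD
    g1 g3 (fun x y => le_rfl)
  have hE := sq_covariance_le hf hf' hd h1 h2 hD h1.abs (by simpa only [habs] using h3)
    (fun x y => abs_abs_sub_abs_le_abs_sub (f y) (f x))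
  simp_rw [habs] at hE
  have hB := sq_integral_le_integral_sq h1.abs (by simpa only [sq_abs] using h2)
  simp_rw [sq_abs] at hB
  rw [I1, I2] at hX
  refine moment_inequality hc hδ hδc (sq_integral_le_integral_sq h1 h2) hfc
    (two_mul_variance_le hf' hd h1 h2 hD) (hX.trans_eq ?_) ?_ hB hE
  · ring
  · rw [I3]; ring



/-- Nonlinear Poincaré-type inequality with diffusion coefficient `0.9`. -/
theorem nonlinear_poincare (C₁ : ℝ) (hC₁ : 0 < C₁) :
    ∃ δ₂ : ℝ, 0 < δ₂ ∧
      ∀ δ : ℝ, 0 < δ → δ ≤ δ₂ →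
        ∀ W W' : ℝ → ℝ,
          (∀ y ∈ Set.Ioo (0 : ℝ) 1, HasDerivAt W (W' y) y) →
          IntegrableOn W (Set.Ioo 0 1) →
          IntegrableOn (fun y => (W y) ^ 2) (Set.Ioo 0 1) →
          IntegrableOn (fun y => |W y| ^ 3) (Set.Ioo 0 1) →
          IntegrableOn (fun y => y * (1 - y) * (W' y) ^ 2) (Set.Ioo 0 1) →
          (∫ y in Set.Ioo (0 : ℝ) 1, (W y) ^ 2) ≤ C₁ →
          -(1 / δ) * ((∫ y in Set.Ioo (0 : ℝ) 1, (W y) ^ 2) +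
                2 * ∫ y in Set.Ioo (0 : ℝ) 1, W y) ^ 2 +
              (1 + δ) * (∫ y in Set.Ioo (0 : ℝ) 1, (W y) ^ 2) +
              (2 / 3) * (∫ y in Set.Ioo (0 : ℝ) 1, (W y) ^ 3) +
              δ * (∫ y in Set.Ioo (0 : ℝ) 1, |W y| ^ 3) -
              (0.9 - δ) * (∫ y in Set.Ioo (0 : ℝ) 1, y * (1 - y) * (W' y) ^ 2) ≤ 0 := by
  have hc : 1 ≤ 1 + C₁ := by linarith
  refine ⟨1 / (10000 * (1 + C₁) ^ 2), by positivity, ?_⟩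
  intro δ hδ hδ₂ W W' hd h1 h2 h3 hD hC
  have hW : ∀ y ∈ Ioo (0 : ℝ) 1, (Ioo (0 : ℝ) 1).indicator W y = W y :=
    fun y hy => indicator_of_mem hy W
  have hW' : ∀ y ∈ Ioo (0 : ℝ) 1, deriv W y = W' y := fun y hy => (hd y hy).deriv
  have hm : Measurable ((Ioo (0 : ℝ) 1).indicator W) := by
    rw [← piecewise_eq_indicator]
    exact ContinuousOn.measurable_piecewise (fun y hy => (hd y hy).continuousAt.continuousWithinAt)
      continuousOn_const measurableSet_Ioo
  have hd' : ∀ y ∈ Ioo (0 : ℝ) 1, HasDerivAt ((Ioo (0 : ℝ) 1).indicator W) (deriv W y) y := by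
    intro y hy
    rw [hW' y hy]
    refine (hd y hy).congr_of_eventuallyEq ?_
    filter_upwards [isOpen_Ioo.mem_nhds hy] with z hz using hW z hz
  have s1 : EqOn ((Ioo (0 : ℝ) 1).indicator W) W (Ioo 0 1) := hW
  have s2 : EqOn (fun y => (Ioo (0 : ℝ) 1).indicator W y ^ 2) (fun y => W y ^ 2) (Ioo 0 1) :=
    fun y hy => by simp only [hW y hy]
  have s3 : EqOn (fun y => (Ioo (0 : ℝ) 1).indicator W y ^ 3) (fun y => W y ^ 3) (Ioo 0 1) :=
    fun y hy => by simp only [hW y hy]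
  have s3' : EqOn (fun y => |(Ioo (0 : ℝ) 1).indicator W y| ^ 3) (fun y => |W y| ^ 3) (Ioo 0 1) :=
    fun y hy => by simp only [hW y hy]
  have sD : EqOn (fun y => y * (1 - y) * deriv W y ^ 2) (fun y => y * (1 - y) * W' y ^ 2)
      (Ioo 0 1) := fun y hy => by simp only [hW' y hy]
  have key := nonlinear_poincare_of_measurable hc hδ ((le_div_iff₀ (by positivity)).1 hδ₂) hm
    (measurable_deriv W) hd' (h1.congr_fun s1.symm measurableSet_Ioo)
    (h2.congr_fun s2.symm measurableSet_Ioo) (h3.congr_fun s3'.symm measurableSet_Ioo)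
    (hD.congr_fun sD.symm measurableSet_Ioo)
    (by rw [setIntegral_congr_fun measurableSet_Ioo s2]; linarith)
  rwa [setIntegral_congr_fun measurableSet_Ioo s1, setIntegral_congr_fun measurableSet_Ioo s2,
    setIntegral_congr_fun measurableSet_Ioo s3, setIntegral_congr_fun measurableSet_Ioo s3',
    setIntegral_congr_fun measurableSet_Ioo sD] at key
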